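/- Soundness and completeness of STDC: for all data α and β, there is an STDC-deduction of β from α if and only if α ≃_ST β (in every semiregular model, α and β have exactly the same truthmakers). -/

import Mathlib

/-- Formulas of classical propositional logic: propositional variables,
negation, conjunction, disjunction. -/
inductive Fml : Type
  | var : ℕ → Fml
  | neg : Fml → Fml
  | conj : Fml → Fml → Fml
  | disj : Fml → Fml → Fml
  deriving DecidableEq

/-- A datum: a finite set of finite sets (components) of formulas. -/
abbrev Datum := Finset (Finset Fml)

/-- Truth-value of a formula under an interpretation of the variables. -/
def Fml.eval (v : ℕ → Bool) : Fml → Bool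
  | .var n => v n
  | .neg A => !A.eval v
  | .conj A B => A.eval v && B.eval v
  | .disj A B => A.eval v || B.eval v

/-- An interpretation verifies a datum iff some component has all its
formulas true. -/
def Verifies (v : ℕ → Bool) (α : Datum) : Prop :=
  ∃ Γ ∈ α, ∀ A ∈ Γ, A.eval v = true

/-- The analytic G-rules of the Data Calculus DC. -/
inductive GStep : Datum → Datum → Prop
  | conj (Γ : Finset Fml) (A B : Fml) (ρ : Datum) :
      GStep (insert (insert (Fml.conj A B) Γ) ρ)
            (insert (insert A (insert B Γ)) ρ)
  | disj (Γ : Finset Fml) (A B : Fml) (ρ : Datum) :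
      GStep (insert (insert (Fml.disj A B) Γ) ρ)
            (insert (insert A Γ) (insert (insert B Γ) ρ))
  | negneg (Γ : Finset Fml) (A : Fml) (ρ : Datum) :
      GStep (insert (insert (Fml.neg (Fml.neg A)) Γ) ρ)
            (insert (insert A Γ) ρ)
  | negdisj (Γ : Finset Fml) (A B : Fml) (ρ : Datum) :
      GStep (insert (insert (Fml.neg (Fml.disj A B)) Γ) ρ)
            (insert (insert (Fml.neg A) (insert (Fml.neg B) Γ)) ρ)
  | negconj (Γ : Finset Fml) (A B : Fml) (ρ : Datum) :
      GStep (insert (insert (Fml.neg (Fml.conj A B)) Γ) ρ)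
            (insert (insert (Fml.neg A) Γ) (insert (insert (Fml.neg B) Γ) ρ))

/-- The analytic N-rule NC: delete a component containing a pair A, ¬A. -/
def NCStep (α β : Datum) : Prop :=
  ∃ (Γ : Finset Fml) (A : Fml),
    α = insert (insert A (insert (Fml.neg A) Γ)) β

/-- The synthetic N-rule EM: replace a component Γ by the two components
Γ∪{A} and Γ∪{¬A}. -/
def EMStep (α β : Datum) : Prop :=
  ∃ (Γ : Finset Fml) (A : Fml) (ρ : Datum),
    α = insert Γ ρ ∧
    β = insert (insert A Γ) (insert (insert (Fml.neg A) Γ) ρ)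

/-- The analytic S-rule Del: replace a component Γ∪Δ by its subset Γ. -/
def DelStep (α β : Datum) : Prop :=
  ∃ (Γ Δ : Finset Fml) (ρ : Datum),
    α = insert (Γ ∪ Δ) ρ ∧ β = insert Γ ρ

/-- The synthetic S-rule Exp: add an arbitrary new component. -/
def ExpStep (α β : Datum) : Prop :=
  ∃ Γ : Finset Fml, β = insert Γ α

/-- Closure of a set of states under (nonempty) fusions. -/
def FusCl {S : Type} (X : Set (Set S)) : Set (Set S) :=
  {s | ∃ Y ⊆ X, Y.Nonempty ∧ s = ⋃₀ Y}

/-- A semiregular bilateral proposition: the truthmaker and falsity-maker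
sets are distinct and each closed under fusions. -/
def SemiRegularProp {S : Type} (P : Set (Set S) × Set (Set S)) : Prop :=
  P.1 ≠ P.2 ∧ FusCl P.1 = P.1 ∧ FusCl P.2 = P.2

/-- The semiregular truthmaker semantics: as the exact semantics but
applying Fus Cl(·) at each stage. -/
def SSem {S : Type} (σ : ℕ → Set (Set S) × Set (Set S)) :
    Fml → Set (Set S) × Set (Set S)
  | .var p => σ p
  | .neg A => ((SSem σ A).2, (SSem σ A).1)
  | .conj A B =>
      (FusCl {s | ∃ s₁ ∈ (SSem σ A).1, ∃ s₂ ∈ (SSem σ B).1, s = s₁ ∪ s₂},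
       FusCl ((SSem σ A).2 ∪ (SSem σ B).2))
  | .disj A B =>
      (FusCl ((SSem σ A).1 ∪ (SSem σ B).1),
       FusCl {s | ∃ s₁ ∈ (SSem σ A).2, ∃ s₂ ∈ (SSem σ B).2, s = s₁ ∪ s₂})

/-- The semiregular truthmakers of a component, read as the conjunction of
its formulas. -/
def SCompTM {S : Type} (σ : ℕ → Set (Set S) × Set (Set S)) (Γ : Finset Fml) :
    Set (Set S) :=
  FusCl {s | ∃ f : Fml → Set S,
        (∀ A ∈ Γ, f A ∈ (SSem σ A).1) ∧ s = ⋃ A ∈ Γ, f A}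

/-- The semiregular truthmakers of a datum, read as the disjunction of its
components. -/
def SDatumTM {S : Type} (σ : ℕ → Set (Set S) × Set (Set S)) (α : Datum) :
    Set (Set S) :=
  FusCl (⋃ Γ ∈ α, SCompTM σ Γ)

/-- ST equivalence of data: the same truthmakers in every semiregular model. -/
def STEquiv (α β : Datum) : Prop :=
  ∀ (S : Type) (σ : ℕ → Set (Set S) × Set (Set S)),
    (∀ p : ℕ, SemiRegularProp (σ p)) → SDatumTM σ α = SDatumTM σ β

section STDCAux

theorem fc_ext {S : Type} (X : Set (Set S)) : X ⊆ FusCl X := by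
  intro s hs
  exact ⟨{s}, by simpa using hs, by simp, by simp⟩

theorem fc_mono {S : Type} {X Y : Set (Set S)} (h : X ⊆ Y) : FusCl X ⊆ FusCl Y := by
  rintro s ⟨Z, hZ, hn, rfl⟩
  exact ⟨Z, hZ.trans h, hn, rfl⟩

theorem fc_idem {S : Type} (X : Set (Set S)) : FusCl (FusCl X) = FusCl X := by
  apply Set.Subset.antisymm _ (fc_ext _)
  rintro s ⟨Z, hZ, ⟨z, hz⟩, rfl⟩
  refine ⟨{x | x ∈ X ∧ ∃ z ∈ Z, x ⊆ z}, fun x hx => hx.1, ?_, ?_⟩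
  · obtain ⟨W, hW, ⟨w, hw⟩, rfl⟩ := hZ hz
    exact ⟨w, hW hw, _, hz, Set.subset_sUnion_of_mem hw⟩
  · ext a
    constructor
    · rintro ⟨z, hz, ha⟩
      obtain ⟨W, hW, _, rfl⟩ := hZ hz
      obtain ⟨w, hw, ha⟩ := ha
      exact ⟨w, ⟨hW hw, _, hz, Set.subset_sUnion_of_mem hw⟩, ha⟩
    · rintro ⟨x, ⟨_, z, hz, hxz⟩, ha⟩
      exact ⟨z, hz, hxz ha⟩

theorem fc_sub {S : Type} {X Y : Set (Set S)} (h : X ⊆ FusCl Y) : FusCl X ⊆ FusCl Y := by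
  rw [← fc_idem Y]; exact fc_mono h

theorem fc_union {S : Type} {X : Set (Set S)} (h : FusCl X = X) {a b : Set S}
    (ha : a ∈ X) (hb : b ∈ X) : a ∪ b ∈ X := by
  rw [← h]
  exact ⟨{a, b}, by rintro x (rfl | rfl) <;> assumption, by simp, by simp⟩

def JJ {S : Type} (X Y : Set (Set S)) : Set (Set S) :=
  {s | ∃ s₁ ∈ X, ∃ s₂ ∈ Y, s = s₁ ∪ s₂}

theorem jj_assoc {S : Type} (X Y Z : Set (Set S)) : JJ (JJ X Y) Z = JJ X (JJ Y Z) := by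
  ext s
  constructor
  · rintro ⟨_, ⟨a, ha, b, hb, rfl⟩, c, hc, rfl⟩
    exact ⟨a, ha, _, ⟨b, hb, c, hc, rfl⟩, Set.union_assoc _ _ _⟩
  · rintro ⟨a, ha, _, ⟨b, hb, c, hc, rfl⟩, rfl⟩
    exact ⟨_, ⟨a, ha, b, hb, rfl⟩, c, hc, (Set.union_assoc _ _ _).symm⟩

theorem jj_union {S : Type} (X Y Z : Set (Set S)) : JJ (X ∪ Y) Z = JJ X Z ∪ JJ Y Z := by
  ext s
  constructor
  · rintro ⟨a, ha | ha, b, hb, rfl⟩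
    · exact Or.inl ⟨a, ha, b, hb, rfl⟩
    · exact Or.inr ⟨a, ha, b, hb, rfl⟩
  · rintro (⟨a, ha, b, hb, rfl⟩ | ⟨a, ha, b, hb, rfl⟩)
    · exact ⟨a, Or.inl ha, b, hb, rfl⟩
    · exact ⟨a, Or.inr ha, b, hb, rfl⟩

theorem fc_jj {S : Type} (X Y R : Set (Set S)) :
    FusCl (JJ (FusCl X) Y ∪ R) = FusCl (JJ X Y ∪ R) := by
  apply Set.Subset.antisymm
  · apply fc_sub
    rintro s (⟨_, ⟨Z, hZ, ⟨z, hz⟩, rfl⟩, b, hb, rfl⟩ | hs)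
    · refine ⟨(fun x => x ∪ b) '' Z, ?_, ⟨_, z, hz, rfl⟩, ?_⟩
      · rintro _ ⟨x, hx, rfl⟩
        exact Or.inl ⟨x, hZ hx, b, hb, rfl⟩
      · ext a
        simp only [Set.mem_union, Set.mem_sUnion, Set.mem_image, exists_exists_and_eq_and]
        constructor
        · rintro (⟨t, ht, ha⟩ | ha)
          · exact ⟨t, ht, Or.inl ha⟩
          · exact ⟨z, hz, Or.inr ha⟩
        · rintro ⟨t, ht, ha | ha⟩
          · exact Or.inl ⟨t, ht, ha⟩
          · exact Or.inr ha
    · exact fc_ext _ (Or.inr hs)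
  · apply fc_mono
    rintro s (⟨a, ha, b, hb, rfl⟩ | hs)
    · exact Or.inl ⟨a, fc_ext _ ha, b, hb, rfl⟩
    · exact Or.inr hs

theorem ssem_closed {S : Type} (σ : ℕ → Set (Set S) × Set (Set S))
    (h : ∀ p, SemiRegularProp (σ p)) (A : Fml) :
    FusCl (SSem σ A).1 = (SSem σ A).1 ∧ FusCl (SSem σ A).2 = (SSem σ A).2 := by
  induction A with
  | var p => exact (h p).2
  | neg A ih => exact ⟨ih.2, ih.1⟩
  | conj A B _ _ => exact ⟨fc_idem _, fc_idem _⟩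
  | disj A B _ _ => exact ⟨fc_idem _, fc_idem _⟩

def CC {S : Type} (σ : ℕ → Set (Set S) × Set (Set S)) (Γ : Finset Fml) : Set (Set S) :=
  {s | ∃ f : Fml → Set S, (∀ A ∈ Γ, f A ∈ (SSem σ A).1) ∧ s = ⋃ A ∈ Γ, f A}

theorem cc_insert {S : Type} (σ : ℕ → Set (Set S) × Set (Set S))
    (h : ∀ p, SemiRegularProp (σ p)) (A : Fml) (Γ : Finset Fml) :
    CC σ (insert A Γ) = JJ (SSem σ A).1 (CC σ Γ) := by
  classical
  ext s
  constructor
  · rintro ⟨f, hf, rfl⟩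
    exact ⟨f A, hf A (by simp), _, ⟨f, fun B hB => hf B (by simp [hB]), rfl⟩, by simp⟩
  · rintro ⟨a, ha, _, ⟨f, hf, rfl⟩, rfl⟩
    refine ⟨fun B => if B = A then (if A ∈ Γ then f A ∪ a else a) else f B, ?_, ?_⟩
    · intro B hB
      by_cases hBA : B = A
      · subst hBA
        by_cases hG : B ∈ Γ
        · simpa [hG] using fc_union (ssem_closed σ h B).1 (hf B hG) ha
        · simpa [hG] using ha
      · simpa [hBA] using hf B (by simpa [hBA] using hB)
    · ext x
      simp only [Set.mem_union, Set.mem_iUnion, Finset.mem_insert, exists_prop]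
      constructor
      · rintro (hx | ⟨B, hB, hx⟩)
        · refine ⟨A, Or.inl rfl, ?_⟩
          by_cases hG : A ∈ Γ <;> simp [hG, hx]
        · refine ⟨B, Or.inr hB, ?_⟩
          by_cases hBA : B = A
          · subst hBA; simp [hB, hx]
          · simp [hBA, hx]
      · rintro ⟨B, hB, hx⟩
        by_cases hBA : B = A
        · subst hBA
          by_cases hG : B ∈ Γ
          · simp [hG] at hx
            rcases hx with hx | hx
            · exact Or.inr ⟨B, hG, hx⟩
            · exact Or.inl hx
          · simp [hG] at hx
            exact Or.inl hx
        · simp [hBA] at hx hB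
          exact Or.inr ⟨B, hB, hx⟩

def RR {S : Type} (σ : ℕ → Set (Set S) × Set (Set S)) (α : Datum) : Set (Set S) :=
  ⋃ Γ ∈ α, CC σ Γ

theorem sdatum_eq {S : Type} (σ : ℕ → Set (Set S) × Set (Set S)) (α : Datum) :
    SDatumTM σ α = FusCl (RR σ α) := by
  apply Set.Subset.antisymm
  · apply fc_sub
    apply Set.iUnion₂_subset
    intro Γ hΓ
    exact fc_mono (Set.subset_biUnion_of_mem (u := fun Γ => CC σ Γ) hΓ)
  · apply fc_mono
    exact Set.iUnion₂_mono fun Γ _ => fc_ext _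

theorem rr_insert {S : Type} (σ : ℕ → Set (Set S) × Set (Set S)) (Γ : Finset Fml) (α : Datum) :
    RR σ (insert Γ α) = CC σ Γ ∪ RR σ α := by
  simp [RR]

theorem gstep_sound {α β : Datum} (hg : GStep α β) : STEquiv α β := by
  intro S σ h
  have hc := fc_jj (S := S)
  have conjL : ∀ X Y G R : Set (Set S),
      FusCl (JJ (FusCl (JJ X Y)) G ∪ R) = FusCl (JJ X (JJ Y G) ∪ R) := by
    intro X Y G R; rw [fc_jj, jj_assoc]
  have disjL : ∀ X Y G R : Set (Set S),
      FusCl (JJ (FusCl (X ∪ Y)) G ∪ R) = FusCl (JJ X G ∪ (JJ Y G ∪ R)) := by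
    intro X Y G R; rw [fc_jj, jj_union, Set.union_assoc]
  cases hg <;> simp only [sdatum_eq, rr_insert, cc_insert σ h]
  · exact conjL _ _ _ _
  · exact disjL _ _ _ _
  · rfl
  · exact conjL _ _ _ _
  · exact disjL _ _ _ _

def DD : Datum → Datum → Prop := Relation.ReflTransGen (fun x y => GStep x y ∨ GStep y x)

theorem DD.rfl' (α : Datum) : DD α α := Relation.ReflTransGen.refl

theorem DD.tr {α β γ : Datum} (h : DD α β) (h' : DD β γ) : DD α γ :=
  Relation.ReflTransGen.trans h h'

theorem DD.sy {α β : Datum} (h : DD α β) : DD β α := by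
  induction h with
  | refl => exact DD.rfl' _
  | tail _ h ih => exact Relation.ReflTransGen.head h.symm ih

theorem DD.of {α β : Datum} (h : GStep α β) : DD α β := Relation.ReflTransGen.single (Or.inl h)

theorem gstep_union {α β : Datum} (h : GStep α β) (ρ : Datum) : GStep (α ∪ ρ) (β ∪ ρ) := by
  cases h <;> simp only [Finset.insert_union] <;> constructor

theorem DD.un {α β : Datum} (h : DD α β) (ρ : Datum) : DD (α ∪ ρ) (β ∪ ρ) := by
  induction h with
  | refl => exact DD.rfl' _
  | tail _ h ih =>
    exact Relation.ReflTransGen.tail ih (h.imp (gstep_union · ρ) (gstep_union · ρ))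

theorem DD.un2 {α β γ δ : Datum} (h : DD α β) (h' : DD γ δ) : DD (α ∪ γ) (β ∪ δ) := by
  refine (h.un γ).tr ?_
  rw [Finset.union_comm β, Finset.union_comm β]
  exact h'.un β

theorem DD.bi (s : Datum) (f g : Finset Fml → Datum) (h : ∀ Γ ∈ s, DD (f Γ) (g Γ)) :
    DD (s.biUnion f) (s.biUnion g) := by
  induction s using Finset.induction_on with
  | empty => exact DD.rfl' _
  | insert a s ha ih =>
    rw [Finset.biUnion_insert, Finset.biUnion_insert]
    exact (h a (by simp)).un2 (ih fun Γ hΓ => h Γ (by simp [hΓ]))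

theorem DD.collapse (Γ : Finset Fml) (hΓ : Γ.Nonempty) :
    ∃ A, ∀ Θ : Finset Fml, DD {Γ ∪ Θ} {insert A Θ} := by
  induction hΓ using Finset.Nonempty.cons_induction with
  | singleton a => exact ⟨a, fun Θ => DD.rfl' _⟩
  | cons a s ha hs ih =>
    obtain ⟨A, hA⟩ := ih
    refine ⟨.conj A a, fun Θ => ?_⟩
    have h1 := hA (insert a Θ)
    have e : Finset.cons a s ha ∪ Θ = s ∪ insert a Θ := by
      rw [Finset.cons_eq_insert, Finset.insert_union, Finset.union_insert]
    rw [e]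
    exact h1.tr (DD.of (GStep.conj Θ A a ∅)).sy

theorem DD.single (A B : Fml) : DD {{A}, {B}} {{A}, {A, B}, {B}} := by
  have h1 : DD {{Fml.disj A B}} {{A}, {B}} := DD.of (GStep.disj ∅ A B ∅)
  have h2 : DD {{Fml.disj A B}} {{A, Fml.disj A B}, {B, Fml.disj A B}} := by
    have := DD.of (GStep.disj {Fml.disj A B} A B ∅)
    simpa using this
  have h3 : DD {{A, Fml.disj A B}} {{A}, {A, B}} := by
    have := DD.of (GStep.disj {A} A B ∅)
    simpa [Finset.pair_comm] using this
  have h4 : DD {{B, Fml.disj A B}} {{A, B}, {B}} := by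
    have := DD.of (GStep.disj {B} A B ∅)
    simpa [Finset.pair_comm] using this
  have h5 := h3.un2 h4
  have h6 := (h1.sy.tr h2).tr h5
  convert h6 using 1
  ext x
  simp

theorem DD.add2 (Γ Δ : Finset Fml) : DD {Γ, Δ} {Γ, Γ ∪ Δ, Δ} := by
  rcases Γ.eq_empty_or_nonempty with rfl | hΓ
  · simpa using DD.rfl' _
  rcases Δ.eq_empty_or_nonempty with rfl | hΔ
  · simpa using DD.rfl' _
  obtain ⟨A, hA⟩ := DD.collapse Γ hΓ
  obtain ⟨B, hB⟩ := DD.collapse Δ hΔ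
  have a : DD {Γ} {{A}} := by simpa using hA ∅
  have b : DD {Δ} {{B}} := by simpa using hB ∅
  have c : DD {Γ ∪ Δ} {{A, B}} := by
    refine (hA Δ).tr ?_
    have := hB {A}
    rw [Finset.pair_comm] at this
    rwa [Finset.union_comm] at this
  exact ((a.un2 b).tr (DD.single A B)).tr (a.un2 (c.un2 b)).sy

theorem DD.add {α : Datum} (Y : Datum) (hY : Y.Nonempty) (hs : Y ⊆ α) :
    DD α (insert (Y.sup id) α) := by
  induction hY using Finset.Nonempty.cons_induction with
  | singleton a =>
    have : a ∈ α := by simpa using hs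
    simpa [this] using DD.rfl' α
  | cons a s ha hs' ih =>
    rw [Finset.cons_eq_insert] at hs ⊢
    have haα : a ∈ α := hs (by simp)
    have h1 := ih ((Finset.subset_insert _ _).trans hs)
    have h2 := (DD.add2 a (s.sup id)).un α
    have e1 : ({a, s.sup id} : Datum) ∪ α = insert (s.sup id) α := by
      ext x; simp; intro h; subst h; exact Or.inr haα
    have e2 : ({a, a ∪ s.sup id, s.sup id} : Datum) ∪ α
        = insert (s.sup id) α ∪ {(insert a s).sup id} := by
      ext x
      simp only [Finset.sup_insert, id, Finset.sup_eq_union, Finset.mem_union, Finset.mem_insert,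
        Finset.mem_singleton]
      constructor
      · rintro ((rfl | h | h) | h) <;> tauto
      · tauto
    rw [e1, e2] at h2
    have h3 := (h1.tr h2).tr (h1.sy.un {(insert a s).sup id})
    rwa [Finset.union_comm, ← Finset.insert_eq] at h3

theorem DD.addAll {α : Datum} (β : Datum)
    (h : ∀ Γ ∈ β, ∃ Y : Datum, Y.Nonempty ∧ Y ⊆ α ∧ Γ = Y.sup id) : DD α (β ∪ α) := by
  induction β using Finset.induction_on with
  | empty => simpa using DD.rfl' α
  | insert a s ha ih =>
    have h1 := ih fun Γ hΓ => h Γ (by simp [hΓ])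
    obtain ⟨Y, hY, hs, rfl⟩ := h a (by simp)
    rw [Finset.insert_union]
    exact h1.tr (DD.add Y hY (hs.trans Finset.subset_union_right))

def IsLit : Fml → Prop
  | .var _ => True
  | .neg (.var _) => True
  | _ => False

def LitD (δ : Datum) : Prop := ∀ Γ ∈ δ, ∀ A ∈ Γ, IsLit A

def NF (Γ : Finset Fml) : Prop :=
  ∃ δ : Datum, LitD δ ∧ ∀ Θ, DD {Γ ∪ Θ} (δ.biUnion fun Δ => {Δ ∪ Θ})

theorem NF.union {Γ Γ' : Finset Fml} (h : NF Γ) (h' : NF Γ') : NF (Γ ∪ Γ') := by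
  obtain ⟨δ, l, d⟩ := h
  obtain ⟨δ', l', d'⟩ := h'
  refine ⟨δ.biUnion fun Δ => δ'.biUnion fun Δ' => {Δ' ∪ Δ}, ?_, ?_⟩
  · intro X hX A hA
    simp only [Finset.mem_biUnion, Finset.mem_singleton] at hX
    obtain ⟨Δ, hΔ, Δ', hΔ', rfl⟩ := hX
    rcases Finset.mem_union.1 hA with hA | hA
    · exact l' _ hΔ' _ hA
    · exact l _ hΔ _ hA
  · intro Θ
    rw [Finset.union_assoc]
    refine (d _).tr ?_
    rw [Finset.biUnion_biUnion]
    apply DD.bi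
    intro Δ _
    have h1 := d' (Δ ∪ Θ)
    rw [Finset.biUnion_biUnion]
    have e : Δ ∪ (Γ' ∪ Θ) = Γ' ∪ (Δ ∪ Θ) := by
      rw [← Finset.union_assoc, Finset.union_comm Δ, Finset.union_assoc]
    rw [e]
    simpa [Finset.union_assoc] using h1

theorem NF.lit {A : Fml} (h : IsLit A) : NF {A} :=
  ⟨{{A}}, by intro Γ hΓ B hB; simp at hΓ; subst hΓ; simp at hB; subst hB; exact h,
    fun Θ => by simpa using DD.rfl' _⟩

theorem NF.one {Γ Γ' : Finset Fml} (h : NF Γ') (hd : ∀ Θ, DD {Γ ∪ Θ} {Γ' ∪ Θ}) : NF Γ := by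
  obtain ⟨δ, l, d⟩ := h
  exact ⟨δ, l, fun Θ => (hd Θ).tr (d Θ)⟩

theorem NF.two {Γ Γ' Γ'' : Finset Fml} (h : NF Γ') (h' : NF Γ'')
    (hd : ∀ Θ, DD {Γ ∪ Θ} {Γ' ∪ Θ, Γ'' ∪ Θ}) : NF Γ := by
  obtain ⟨δ, l, d⟩ := h
  obtain ⟨δ', l', d'⟩ := h'
  refine ⟨δ ∪ δ', ?_, fun Θ => (hd Θ).tr ?_⟩
  · intro Δ hΔ
    rcases Finset.mem_union.1 hΔ with h | h
    · exact l _ h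
    · exact l' _ h
  · rw [Finset.union_biUnion]
    exact (d Θ).un2 (d' Θ)

theorem NF.fml (A : Fml) : NF {A} ∧ NF {Fml.neg A} := by
  induction A with
  | var p => exact ⟨NF.lit trivial, NF.lit trivial⟩
  | neg A ih => exact ⟨ih.2, ih.1.one fun Θ => DD.of (GStep.negneg Θ A ∅)⟩
  | conj A B ihA ihB =>
    refine ⟨(ihA.1.union ihB.1).one fun Θ => ?_, ihA.2.two ihB.2 fun Θ => ?_⟩
    · have := DD.of (GStep.conj Θ A B ∅)
      rw [Finset.union_assoc]
      exact this
    · exact DD.of (GStep.negconj Θ A B ∅)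
  | disj A B ihA ihB =>
    refine ⟨ihA.1.two ihB.1 fun Θ => ?_, (ihA.2.union ihB.2).one fun Θ => ?_⟩
    · exact DD.of (GStep.disj Θ A B ∅)
    · have := DD.of (GStep.negdisj Θ A B ∅)
      rw [Finset.union_assoc]
      exact this

theorem NF.all (Γ : Finset Fml) : NF Γ := by
  induction Γ using Finset.induction_on with
  | empty => exact ⟨{∅}, by intro Γ hΓ; simp at hΓ; subst hΓ; simp, fun Θ => by simpa using DD.rfl' _⟩
  | insert a s _ ih => exact (NF.fml a).1.union ih

theorem dnf (α : Datum) : ∃ δ, LitD δ ∧ DD α δ := by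
  choose f hl hd using NF.all
  refine ⟨α.biUnion f, ?_, ?_⟩
  · intro Γ hΓ
    obtain ⟨Δ, _, h⟩ := Finset.mem_biUnion.1 hΓ
    exact hl Δ Γ h
  · have := DD.bi α (fun Γ => {Γ}) f fun Γ _ => by simpa using hd Γ ∅
    simpa using this

def canon (p : ℕ) : Set (Set Fml) × Set (Set Fml) :=
  ({{Fml.var p}}, {{Fml.neg (Fml.var p)}})

theorem fc_singleton {S : Type} (s : Set S) : FusCl {s} = {s} := by
  apply Set.Subset.antisymm _ (fc_ext _)
  rintro t ⟨Y, hY, hn, rfl⟩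
  rcases Set.subset_singleton_iff_eq.1 hY with rfl | rfl
  · simp at hn
  · simp

theorem canon_ok (p : ℕ) : SemiRegularProp (canon p) :=
  ⟨by simp [canon], fc_singleton _, fc_singleton _⟩

theorem canon_lit {A : Fml} (h : IsLit A) : (SSem canon A).1 = {{A}} := by
  match A, h with
  | .var p, _ => rfl
  | .neg (.var p), _ => rfl

theorem canon_cc {Γ : Finset Fml} (h : ∀ A ∈ Γ, IsLit A) : CC canon Γ = {(Γ : Set Fml)} := by
  have key : ∀ f : Fml → Set Fml, (∀ A ∈ Γ, f A = {A}) → (⋃ A ∈ Γ, f A) = (Γ : Set Fml) := by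
    intro f hf
    ext x
    simp only [Set.mem_iUnion, exists_prop, Finset.mem_coe]
    constructor
    · rintro ⟨A, hA, hx⟩
      rw [hf A hA] at hx
      rw [Set.mem_singleton_iff.1 hx]; exact hA
    · intro hx
      exact ⟨x, hx, by rw [hf x hx]; rfl⟩
  ext s
  constructor
  · rintro ⟨f, hf, rfl⟩
    apply key
    intro A hA
    simpa [canon_lit (h A hA)] using hf A hA
  · rintro rfl
    exact ⟨fun A => {A}, fun A hA => by simp [canon_lit (h A hA)], (key _ fun _ _ => rfl).symm⟩

theorem canon_cover {α β : Datum} (hα : LitD α) (hβ : LitD β)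
    (h : SDatumTM canon α = SDatumTM canon β) :
    ∀ Γ ∈ β, ∃ Y : Datum, Y.Nonempty ∧ Y ⊆ α ∧ Γ = Y.sup id := by
  classical
  intro Γ hΓ
  have h1 : (Γ : Set Fml) ∈ SDatumTM canon β := by
    rw [sdatum_eq]
    apply fc_ext
    refine Set.mem_biUnion hΓ ?_
    rw [canon_cc (hβ Γ hΓ)]; rfl
  rw [← h, sdatum_eq] at h1
  obtain ⟨Z, hZ, ⟨z, hz⟩, e⟩ := h1
  have hz' : ∀ z ∈ Z, ∃ Δ ∈ α, z = (Δ : Set Fml) := by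
    intro z hz
    have := hZ hz
    simp only [RR, Set.mem_iUnion, exists_prop] at this
    obtain ⟨Δ, hΔ, hh⟩ := this
    rw [canon_cc (hα Δ hΔ)] at hh
    exact ⟨Δ, hΔ, hh⟩
  refine ⟨α.filter fun Δ => (Δ : Set Fml) ∈ Z, ?_, Finset.filter_subset _ _, ?_⟩
  · obtain ⟨Δ, hΔ, rfl⟩ := hz' z hz
    exact ⟨Δ, by simp [hΔ, hz]⟩
  · ext x
    rw [← Finset.mem_coe, e]
    simp only [Set.mem_sUnion, Finset.mem_sup, Finset.mem_filter, id]
    constructor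
    · rintro ⟨t, ht, hx⟩
      obtain ⟨Δ, hΔ, rfl⟩ := hz' t ht
      exact ⟨Δ, ⟨hΔ, ht⟩, hx⟩
    · rintro ⟨Δ, ⟨_, ht⟩, hx⟩
      exact ⟨_, ht, hx⟩

theorem DD.sound {α β : Datum} (h : DD α β) : STEquiv α β := by
  induction h with
  | refl => intro S σ _; rfl
  | tail _ h ih =>
    intro S σ hσ
    rw [ih S σ hσ]
    rcases h with h | h
    · exact gstep_sound h S σ hσ
    · exact (gstep_sound h S σ hσ).symm

theorem DD.complete {α β : Datum} (h : STEquiv α β) : DD α β := by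
  obtain ⟨α', la, da⟩ := dnf α
  obtain ⟨β', lb, db⟩ := dnf β
  have e : SDatumTM canon α' = SDatumTM canon β' := by
    rw [← da.sound _ canon canon_ok, ← db.sound _ canon canon_ok]
    exact h _ canon canon_ok
  have h1 := DD.addAll β' (canon_cover la lb e)
  have h2 := DD.addAll α' (canon_cover lb la e.symm)
  rw [Finset.union_comm] at h2
  exact ((da.tr h1).tr h2.sy).tr db.sy

end STDCAux

/-- Soundness and completeness of STDC (whose rules are exactly the G-rules
in both directions): β is STDC-deducible from α iff α ≃_ST β. -/
theorem stdc_soundness_completeness (α β : Datum) :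
    Relation.ReflTransGen (fun x y => GStep x y ∨ GStep y x) α β ↔
      STEquiv α β := by
  exact ⟨DD.sound, DD.complete⟩
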